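/- arXiv:math/0211394 — 2 statements merged into one kernel-verified Lean document; each statement's English description precedes it below -/
import Mathlib

section
/- Every finite subgroup of GL₂(ℚ) is isomorphic (as an abstract group) to a subgroup of the dihedral group of order 8 or to a subgroup of the dihedral group of order 12. -/
/-- A group `G` that is a union of two cosets of `N = ker f`, where `N` embeds in the cyclic group
of order `m` and every element outside `N` is an involution, embeds in the dihedral group of
order `2m`. -/
theorem exists_injective_dihedralGroup {G A : Type*} [Group G] [Group A] (f : G →* A) (m : ℕ)
    (φ : f.ker →* Multiplicative (ZMod m)) (hφ : Function.Injective φ)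
    (hmul : ∀ x y, x ∉ f.ker → y ∉ f.ker → x * y ∈ f.ker)
    (hinv : ∀ x, x ∉ f.ker → x * x = 1) :
    ∃ F : G →* DihedralGroup m, Function.Injective F := by
  classical
  by_cases h : ∃ s, s ∉ f.ker
  · obtain ⟨s, hs⟩ := h
    have hss : s * s = 1 := hinv s hs
    let ψ : G → ZMod m := fun x => if hx : x ∈ f.ker then (φ ⟨x, hx⟩).toAdd else 0
    have ψ_mul : ∀ x y, x ∈ f.ker → y ∈ f.ker → ψ (x * y) = ψ x + ψ y := by
      intro x y hx hy
      have hxy := mul_mem hx hy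
      simp only [ψ, dif_pos hx, dif_pos hy, dif_pos hxy]
      rw [← toAdd_mul, ← map_mul]
      rfl
    have ψ_inj : ∀ x y, x ∈ f.ker → y ∈ f.ker → ψ x = ψ y → x = y := by
      intro x y hx hy hxy
      simp only [ψ, dif_pos hx, dif_pos hy] at hxy
      exact congrArg Subtype.val (hφ (Multiplicative.toAdd.injective hxy))
    have conj : ∀ a, a ∈ f.ker → s * a * s = a⁻¹ := by
      intro a ha
      have hsa : s * a ∉ f.ker := fun hc => hs ((Subgroup.mul_mem_cancel_right _ ha).1 hc)
      rw [eq_inv_iff_mul_eq_one]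
      simpa [mul_assoc] using hinv _ hsa
    have ψ_inv : ∀ x, x ∈ f.ker → ψ x⁻¹ = - ψ x := by
      intro x hx
      have h1 : ψ 1 = 0 := by simpa using ψ_mul 1 1 (one_mem _) (one_mem _)
      have h2 := ψ_mul x⁻¹ x (inv_mem hx) hx
      rw [inv_mul_cancel, h1] at h2
      exact eq_neg_of_add_eq_zero_left h2.symm
    have ψ_conj : ∀ x, x ∈ f.ker → ψ (s * x * s) = - ψ x := fun x hx => by
      rw [conj x hx, ψ_inv x hx]
    let F : G → DihedralGroup m := fun x =>
      if x ∈ f.ker then .r (ψ x) else .sr (ψ (s * x))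
    have F_mul : ∀ x y, F (x * y) = F x * F y := by
      intro x y
      by_cases hx : x ∈ f.ker <;> by_cases hy : y ∈ f.ker
      · simp only [F, if_pos hx, if_pos hy, if_pos (mul_mem hx hy), DihedralGroup.r_mul_r,
          ψ_mul x y hx hy]
      · have hxy : x * y ∉ f.ker := fun hc => hy ((Subgroup.mul_mem_cancel_left _ hx).1 hc)
        have e : s * (x * y) = (s * x * s) * (s * y) := by
          rw [mul_assoc _ s, ← mul_assoc s s, hss, one_mul, mul_assoc]
        have hc : s * x * s ∈ f.ker := by rw [conj x hx]; exact inv_mem hx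
        simp only [F, if_pos hx, if_neg hy, if_neg hxy, DihedralGroup.r_mul_sr]
        rw [e, ψ_mul _ _ hc (hmul _ _ hs hy), ψ_conj x hx, neg_add_eq_sub]
      · have hxy : x * y ∉ f.ker := fun hc => hx ((Subgroup.mul_mem_cancel_right _ hy).1 hc)
        simp only [F, if_neg hx, if_pos hy, if_neg hxy, DihedralGroup.sr_mul_r]
        rw [← mul_assoc, ψ_mul _ _ (hmul _ _ hs hx) hy]
      · have e : x * y = (s * (s * x) * s) * (s * y) := by
          rw [mul_assoc _ s, ← mul_assoc s s, ← mul_assoc s s, hss, one_mul, one_mul]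
        have hsx := hmul _ _ hs hx
        have hc : s * (s * x) * s ∈ f.ker := by rw [conj _ hsx]; exact inv_mem hsx
        simp only [F, if_neg hx, if_neg hy, if_pos (hmul _ _ hx hy), DihedralGroup.sr_mul_sr]
        rw [e, ψ_mul _ _ hc (hmul _ _ hs hy), ψ_conj _ hsx, neg_add_eq_sub]
    refine ⟨MonoidHom.mk' F F_mul, fun x y hxy => ?_⟩
    replace hxy : F x = F y := hxy
    by_cases hx : x ∈ f.ker <;> by_cases hy : y ∈ f.ker
    · simp only [F, if_pos hx, if_pos hy, DihedralGroup.r.injEq] at hxy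
      exact ψ_inj x y hx hy hxy
    · simp only [F, if_pos hx, if_neg hy, reduceCtorEq] at hxy
    · simp only [F, if_neg hx, if_pos hy, reduceCtorEq] at hxy
    · simp only [F, if_neg hx, if_neg hy, DihedralGroup.sr.injEq] at hxy
      exact mul_left_cancel (ψ_inj _ _ (hmul _ _ hs hx) (hmul _ _ hs hy) hxy)
  · push Not at h
    let F : G →* DihedralGroup m := MonoidHom.mk' (fun x => .r (φ ⟨x, h x⟩).toAdd) (by
      intro x y
      rw [DihedralGroup.r_mul_r, ← toAdd_mul, ← map_mul]
      rfl)
    refine ⟨F, fun x y hxy => ?_⟩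
    have hxy' := DihedralGroup.r.inj hxy
    exact congrArg Subtype.val (hφ (Multiplicative.toAdd.injective hxy'))

/-- A finite-order complex number with rational trace `z + z⁻¹` has order dividing `4` or `6`. -/
theorem pow_four_or_six_eq_one {z : ℂ} {n : ℕ} (hn : n ≠ 0) (hz : z ^ n = 1) {t : ℚ}
    (ht : z ^ 2 - t * z + 1 = 0) : z ^ 4 = 1 ∨ z ^ 6 = 1 := by
  have hz0 : z ≠ 0 := by
    rintro rfl
    simp [hn] at hz
  have htz : (t : ℂ) = z + z⁻¹ := by
    field_simp
    linear_combination -ht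
  have hint : IsIntegral ℤ z :=
    IsIntegral.of_pow (Nat.pos_of_ne_zero hn) (hz ▸ isIntegral_one)
  have hint' : IsIntegral ℤ z⁻¹ :=
    IsIntegral.of_pow (Nat.pos_of_ne_zero hn) (by rw [inv_pow, hz, inv_one]; exact isIntegral_one)
  have htint : IsIntegral ℤ (algebraMap ℚ ℂ t) := by
    rw [eq_ratCast, htz]
    exact hint.add hint'
  rw [isIntegral_algebraMap_iff (algebraMap ℚ ℂ).injective] at htint
  obtain ⟨k, rfl⟩ := IsIntegrallyClosed.isIntegral_iff.1 htint
  have hnorm : ‖z‖ = 1 := Complex.norm_eq_one_of_pow_eq_one hz hn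
  simp only [eq_intCast, Rat.cast_intCast] at ht htz
  have hk : |(k : ℝ)| ≤ 2 := by
    have := norm_add_le z z⁻¹
    rw [← htz, norm_inv, hnorm, Complex.norm_intCast] at this
    linarith
  have hk' : |k| ≤ 2 := by exact_mod_cast hk
  obtain ⟨h1, h2⟩ := abs_le.1 hk'
  interval_cases k
  · have : z = -1 := by
      have h : (z + 1) ^ 2 = 0 := by push_cast at ht; linear_combination ht
      exact eq_neg_of_add_eq_zero_left (pow_eq_zero_iff two_ne_zero |>.1 h)
    left; rw [this]; norm_num
  · right; push_cast at ht; linear_combination (z - 1) * (z ^ 3 + 1) * ht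
  · left; push_cast at ht; linear_combination (z ^ 2 - 1) * ht
  · right; push_cast at ht; linear_combination (z + 1) * (z ^ 3 - 1) * ht
  · have : z = 1 := by
      have h : (z - 1) ^ 2 = 0 := by push_cast at ht; linear_combination ht
      exact sub_eq_zero.1 (pow_eq_zero_iff two_ne_zero |>.1 h)
    left; rw [this]; norm_num

/-- A finite subgroup of `GL₂(ℚ)` preserves a positive definite quadratic form. -/
theorem exists_invariant_form (H : Subgroup (GL (Fin 2) ℚ)) [Finite H] :
    ∃ a b c : ℚ, 0 < c ∧ b ^ 2 < a * c ∧ ∀ h ∈ H,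
      h.1.transpose * !![a, b; b, c] * h.1 = !![a, b; b, c] := by
  have := Fintype.ofFinite H
  let Q : Matrix (Fin 2) (Fin 2) ℚ := ∑ g : H, g.1.1.transpose * g.1.1
  have hsymm : Q 1 0 = Q 0 1 := by
    simp only [Q, Matrix.sum_apply, Matrix.mul_apply, Matrix.transpose_apply, Fin.sum_univ_two]
    exact Finset.sum_congr rfl fun _ _ => by ring
  have hQ : !![Q 0 0, Q 0 1; Q 0 1, Q 1 1] = Q := by
    rw [Matrix.eta_fin_two Q, hsymm]; rfl
  have hpos : ∀ x y : ℚ, x ^ 2 + y ^ 2 ≤ Q 0 0 * x ^ 2 + 2 * Q 0 1 * (x * y) + Q 1 1 * y ^ 2 := by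
    intro x y
    let N : H → ℚ := fun g =>
      (g.1.1 0 0 * x + g.1.1 0 1 * y) ^ 2 + (g.1.1 1 0 * x + g.1.1 1 1 * y) ^ 2
    have h1 : N 1 ≤ ∑ g, N g :=
      Finset.single_le_sum (fun g _ => by positivity) (Finset.mem_univ 1)
    have h2 : N 1 = x ^ 2 + y ^ 2 := by simp [N]
    have h3 : ∑ g, N g = Q 0 0 * x ^ 2 + 2 * Q 0 1 * (x * y) + Q 1 1 * y ^ 2 := by
      simp only [Q, Matrix.sum_apply, Matrix.mul_apply, Matrix.transpose_apply, Fin.sum_univ_two,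
        Finset.sum_mul, Finset.mul_sum, ← Finset.sum_add_distrib]
      exact Finset.sum_congr rfl fun _ _ => by simp only [N]; ring
    linarith
  have hc : 0 < Q 1 1 := by linarith [hpos 0 1]
  refine ⟨Q 0 0, Q 0 1, Q 1 1, hc, ?_, fun h hh => ?_⟩
  · have h1 := hpos (Q 1 1) (-Q 0 1)
    have h2 : 0 < Q 1 1 * (Q 0 0 * Q 1 1 - Q 0 1 ^ 2) := by
      nlinarith [pow_pos hc 2, sq_nonneg (Q 0 1)]
    linarith [(mul_pos_iff_of_pos_left hc).1 h2]
  · rw [hQ]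
    simp only [Q, Finset.mul_sum, Finset.sum_mul]
    refine Fintype.sum_equiv (Equiv.mulRight (⟨h, hh⟩ : H)) _ _ fun g => ?_
    simp [Matrix.transpose_mul, mul_assoc]

/-- The second row of `δ Q h = (adj h)ᵀ Q` for an isometry `h` of determinant `δ`. -/
theorem isometry_entries {a b c p q r s δ : ℚ}
    (hQ : (!![p, q; r, s] : Matrix (Fin 2) (Fin 2) ℚ).transpose * !![a, b; b, c] * !![p, q; r, s]
      = !![a, b; b, c]) (hδ : p * s - q * r = δ) :
    δ * (b * p + c * r) = p * b - q * a ∧ δ * (b * q + c * s) = p * c - q * b := by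
  have h00 := congrFun (congrFun hQ 0) 0
  have h01 := congrFun (congrFun hQ 0) 1
  have h10 := congrFun (congrFun hQ 1) 0
  have h11 := congrFun (congrFun hQ 1) 1
  simp [Matrix.mul_apply, Fin.sum_univ_two] at h00 h01 h10 h11
  subst hδ
  constructor
  · linear_combination p * h10 - q * h00
  · linear_combination p * h11 - q * h01

/-- The determinant-one subgroup of a finite subgroup of `GL₂(ℚ)` acts faithfully through the
eigenvalue on a common nonreal eigenvector `(1, τ)`. -/
theorem exists_eigenvalue_hom {a b c : ℚ} (hc : 0 < c) (hD : b ^ 2 < a * c)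
    {N : Type*} [Group N] (ι : N →* GL (Fin 2) ℚ) (hι : Function.Injective ι)
    (hdet : ∀ x, (ι x).1.det = 1)
    (hQ : ∀ x, (ι x).1.transpose * !![a, b; b, c] * (ι x).1 = !![a, b; b, c]) :
    ∃ l : N →* ℂ, Function.Injective l ∧ ∀ x, ∃ t : ℚ, l x ^ 2 - t * l x + 1 = 0 := by
  obtain ⟨τ, hτ, him⟩ : ∃ τ : ℂ, (c : ℂ) * τ ^ 2 + 2 * b * τ + a = 0 ∧ τ.im ≠ 0 := by
    have hc' : (0 : ℝ) < c := by exact_mod_cast hc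
    have hD' : (0 : ℝ) < a * c - b ^ 2 := by
      have : (b : ℝ) ^ 2 < a * c := by exact_mod_cast hD
      linarith
    have hw := Real.sq_sqrt hD'.le
    have hw0 := Real.sqrt_pos.2 hD'
    set w := √((a : ℝ) * c - b ^ 2)
    have hwC : (w : ℂ) ^ 2 = a * c - b ^ 2 := by exact_mod_cast congrArg Complex.ofReal hw
    have hcC : (c : ℂ) ≠ 0 := by exact_mod_cast hc.ne'
    refine ⟨⟨-b / c, w / c⟩, ?_, (div_pos hw0 hc').ne'⟩
    have e : (⟨-b / c, w / c⟩ : ℂ) = (-b + w * Complex.I) / c := by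
      rw [Complex.mk_eq_add_mul_I]
      push_cast
      ring
    rw [e]
    field_simp
    linear_combination (w : ℂ) ^ 2 * Complex.I_sq - hwC
  have hreal : ∀ x y : ℚ, (x : ℂ) + y * τ = 0 → x = 0 ∧ y = 0 := by
    intro x y h
    have h1 := congrArg Complex.im h
    have h2 := congrArg Complex.re h
    simp [him] at h1 h2
    subst h1
    simpa using h2
  have hcC : (c : ℂ) ≠ 0 := by exact_mod_cast hc.ne'
  have hfix : ∀ x, ((ι x).1 1 0 : ℂ) + (ι x).1 1 1 * τ =
      ((ι x).1 0 0 + (ι x).1 0 1 * τ) * τ := by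
    intro x
    have h := hQ x
    have hd := hdet x
    rw [Matrix.det_fin_two] at hd
    rw [Matrix.eta_fin_two (ι x).1] at h
    obtain ⟨h1, h2⟩ := isometry_entries h hd
    have h1' := congrArg (Rat.cast : ℚ → ℂ) h1
    have h2' := congrArg (Rat.cast : ℚ → ℂ) h2
    push_cast at h1' h2'
    apply mul_left_cancel₀ hcC
    linear_combination h1' + τ * h2' - ((ι x).1 0 1 : ℂ) * hτ
  let l : N →* ℂ :=
    { toFun := fun x => (ι x).1 0 0 + (ι x).1 0 1 * τ
      map_one' := by simp
      map_mul' := by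
        intro x y
        simp only [map_mul, Units.val_mul, Matrix.mul_apply, Fin.sum_univ_two]
        push_cast
        linear_combination ((ι x).1 0 1 : ℂ) * hfix y }
  refine ⟨l, fun x y hxy => hι (Units.ext ?_), fun x => ⟨(ι x).1 0 0 + (ι x).1 1 1, ?_⟩⟩
  · have hxy' : ((ι x).1 0 0 : ℂ) + (ι x).1 0 1 * τ = (ι y).1 0 0 + (ι y).1 0 1 * τ := hxy
    obtain ⟨h1, h2⟩ := hreal ((ι x).1 0 0 - (ι y).1 0 0) ((ι x).1 0 1 - (ι y).1 0 1) (by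
      push_cast; linear_combination hxy')
    obtain ⟨h3, h4⟩ := hreal ((ι x).1 1 0 - (ι y).1 1 0) ((ι x).1 1 1 - (ι y).1 1 1) (by
      push_cast; linear_combination hfix x - hfix y + τ * hxy')
    ext i j
    fin_cases i <;> fin_cases j
    exacts [sub_eq_zero.1 h1, sub_eq_zero.1 h2, sub_eq_zero.1 h3, sub_eq_zero.1 h4]
  · have hd := hdet x
    rw [Matrix.det_fin_two] at hd
    have hd' := congrArg (Rat.cast : ℚ → ℂ) hd
    simp only [l, MonoidHom.coe_mk, OneHom.coe_mk]
    push_cast at hd' ⊢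
    linear_combination -hd' - ((ι x).1 0 1 : ℂ) * hfix x

theorem exists_injective_zmod {N : Type*} [Group N] (m : ℕ) [NeZero m] (l : N →* ℂ)
    (hl : Function.Injective l) (hm : ∀ x, l x ^ m = 1) :
    ∃ φ : N →* Multiplicative (ZMod m), Function.Injective φ := by
  let e : rootsOfUnity m ℂ ≃* Multiplicative (ZMod m) :=
    mulEquivOfCyclicCardEq (by
      rw [Complex.card_rootsOfUnity]
      simp)
  let u : N →* rootsOfUnity m ℂ := l.toHomUnits.codRestrict _ fun x => by
    rw [mem_rootsOfUnity]
    exact Units.ext (by simpa using hm x)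
  refine ⟨e.toMonoidHom.comp u, e.injective.comp fun x y hxy => hl ?_⟩
  exact congrArg (fun z : rootsOfUnity m ℂ => (z.1 : ℂ)) hxy

theorem exists_injective_zmod_four_or_six {N : Type*} [Group N] [Finite N] (l : N →* ℂ)
    (hl : Function.Injective l) (ht : ∀ x, ∃ t : ℚ, l x ^ 2 - t * l x + 1 = 0) :
    (∃ φ : N →* Multiplicative (ZMod 4), Function.Injective φ) ∨
    (∃ φ : N →* Multiplicative (ZMod 6), Function.Injective φ) := by
  have : IsCyclic N := isCyclic_of_injective_ringHom l hl
  obtain ⟨g, hg⟩ := IsCyclic.exists_generator (α := N)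
  have key : ∀ m, l g ^ m = 1 → ∀ x, l x ^ m = 1 := by
    intro m h x
    obtain ⟨k, rfl⟩ := Subgroup.mem_zpowers_iff.1 (hg x)
    rw [← map_pow, map_eq_one_iff l hl] at h ⊢
    rw [← zpow_natCast, zpow_comm, zpow_natCast, h, one_zpow]
  obtain ⟨t, htg⟩ := ht g
  have hn : l g ^ orderOf g = 1 := by rw [← map_pow, pow_orderOf_eq_one, map_one]
  exact (pow_four_or_six_eq_one (orderOf_pos g).ne' hn htg).imp
    (fun h => exists_injective_zmod 4 l hl (key 4 h))
    (fun h => exists_injective_zmod 6 l hl (key 6 h))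

/-- Every finite subgroup of `GL₂(ℚ)` is isomorphic to a subgroup of the dihedral
group of order 8 or to a subgroup of the dihedral group of order 12. -/
theorem stmt_1 (H : Subgroup (GL (Fin 2) ℚ)) (hH : Finite H) :
    (∃ K : Subgroup (DihedralGroup 4), Nonempty (H ≃* K)) ∨
    (∃ K : Subgroup (DihedralGroup 6), Nonempty (H ≃* K)) := by
  obtain ⟨a, b, c, hc, hD, hQ⟩ := exists_invariant_form H
  let f : H →* ℚˣ := Matrix.GeneralLinearGroup.det.comp H.subtype
  have mem_ker : ∀ x : H, x ∈ f.ker ↔ x.1.1.det = 1 := fun x => by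
    simp [f, MonoidHom.mem_ker, Units.ext_iff]
  have det_eq : ∀ x : H, x ∉ f.ker → x.1.1.det = -1 := by
    intro x hx
    have h1 : x.1.1.det ^ Nat.card H = 1 := by
      rw [← Matrix.det_pow, ← Units.val_pow_eq_pow_val, ← Subgroup.coe_pow, pow_card_eq_one']
      simp
    exact ((pow_eq_one_iff_cases.1 h1).resolve_left Nat.card_pos.ne').resolve_left
      (fun h => hx ((mem_ker x).2 h)) |>.1
  have hmul : ∀ x y, x ∉ f.ker → y ∉ f.ker → x * y ∈ f.ker := by
    intro x y hx hy
    rw [mem_ker]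
    simp [det_eq x hx, det_eq y hy]
  have hinv : ∀ x, x ∉ f.ker → x * x = 1 := by
    intro x hx
    have hd := det_eq x hx
    have h := hQ x.1 x.2
    rw [Matrix.det_fin_two] at hd
    rw [Matrix.eta_fin_two x.1.1] at h
    have h2 := (isometry_entries h hd).2
    have htr : x.1.1 1 1 = -x.1.1 0 0 :=
      mul_left_cancel₀ hc.ne' (by linear_combination -h2)
    rw [htr] at hd
    refine Subtype.ext (Units.ext ?_)
    change x.1.1 * x.1.1 = 1
    rw [Matrix.eta_fin_two x.1.1, htr, Matrix.one_fin_two, Matrix.mul_fin_two]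
    ext i j
    fin_cases i <;> fin_cases j <;> simp <;> grind
  obtain ⟨l, hl, ht⟩ := exists_eigenvalue_hom hc hD (H.subtype.comp f.ker.subtype)
    (H.subtype_injective.comp f.ker.subtype_injective) (fun x => (mem_ker x.1).1 x.2)
    (fun x => hQ x.1.1 x.1.2)
  have key : ∀ m, (∃ φ : f.ker →* Multiplicative (ZMod m), Function.Injective φ) →
      ∃ K : Subgroup (DihedralGroup m), Nonempty (H ≃* K) := by
    rintro m ⟨φ, hφ⟩
    obtain ⟨F, hF⟩ := exists_injective_dihedralGroup f m φ hφ hmul hinv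
    exact ⟨F.range, ⟨MonoidHom.ofInjective hF⟩⟩
  exact (exists_injective_zmod_four_or_six l hl ht).imp (key 4) (key 6)
end

section
/- Let k be a field of characteristic zero and g ≥ 2 an integer. Let F and F′ be squarefree polynomials in k[x], each of degree 2g+1 or 2g+2, and let K_F and K_{F′} be the corresponding hyperelliptic function fields. Then every k-algebra isomorphism σ : K_{F′} → K_F is represented by some pair (M, e) with M ∈ GL₂(k) and e ∈ kˣ; that is, writing M = [[a,b],[c,d]], one has σ(x′) = (a x + b)/(c x + d) and σ(y′) = e·y/(c x + d)^{g+1}. -/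
open Polynomial

/-- Data exhibiting a field `K` (with a `k`-algebra structure) as the hyperelliptic
function field `k(x)(y)` with `y² = F(x)`: elements `x, y ∈ K` with `x` transcendental
over `k`, `y² = F(x)`, and `K` generated as a field over `k` by `x` and `y`. -/
structure IsHyperellipticFunctionField (k : Type*) [Field k] (F : k[X])
    (K : Type*) [Field K] [Algebra k K] (x y : K) : Prop where
  transcendental_x : Transcendental k x
  sq : y ^ 2 = Polynomial.aeval x F
  adjoin_eq_top : IntermediateField.adjoin k ({x, y} : Set K) = ⊤

/-- The pair `(M, e)`, with `M = [[a,b],[c,d]] ∈ GL₂(k)` and `e ∈ kˣ`, represents the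
`k`-algebra isomorphism `σ : K' → K` (where `K' = k(x')(y')` with `y'² = F'(x')` and
`K = k(x)(y)` with `y² = F(x)`, both of genus `g`) if
`σ(x') = (a x + b)/(c x + d)` and `σ(y') = e y/(c x + d)^{g+1}`. -/
def Represents {k : Type*} [Field k] {K K' : Type*} [Field K] [Algebra k K]
    [Field K'] [Algebra k K'] (g : ℕ) (x y : K) (x' y' : K')
    (σ : K' ≃ₐ[k] K) (M : GL (Fin 2) k) (e : kˣ) : Prop :=
  σ x' = (algebraMap k K (M.val 0 0) * x + algebraMap k K (M.val 0 1)) /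
      (algebraMap k K (M.val 1 0) * x + algebraMap k K (M.val 1 1)) ∧
  σ y' = algebraMap k K (e : k) * y /
      (algebraMap k K (M.val 1 0) * x + algebraMap k K (M.val 1 1)) ^ (g + 1)


section QuadraticExtension

variable {R E K : Type*} [CommRing R] [Field E] [Algebra R E] [IsFractionRing R E]
  [Field K] [Algebra R K] [Algebra E K] [IsScalarTower R E K]

/-- An integrally closed domain contains the square roots in its fraction field of its elements. -/
lemma exists_algebraMap_eq_of_sq_eq [IsIntegrallyClosed R] {z : E} {r : R}
    (h : z ^ 2 = algebraMap R E r) : ∃ m : R, algebraMap R E m = z :=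
  IsIntegrallyClosed.exists_algebraMap_eq_of_isIntegral_pow two_pos (h ▸ isIntegral_algebraMap)

/-- A square root of a squarefree non-unit is not in the fraction field. -/
lemma algebraMap_ne_of_sq_eq_squarefree [IsDomain R] [IsIntegrallyClosed R] {f : R}
    (hf : Squarefree f)
    (hfu : ¬ IsUnit f) {y : K} (hy : y ^ 2 = algebraMap R K f) (z : E) :
    algebraMap E K z ≠ y := by
  rintro rfl
  have hz : z ^ 2 = algebraMap R E f := by
    apply (algebraMap E K).injective
    rw [map_pow, hy, ← IsScalarTower.algebraMap_apply]
  obtain ⟨m, rfl⟩ := exists_algebraMap_eq_of_sq_eq hz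
  have hm : m ^ 2 = f := by
    apply IsFractionRing.injective R E
    rw [map_pow, hz]
  have := hf m (by rw [← hm, sq])
  exact hfu (hm ▸ this.pow 2)

open IntermediateField in
/-- Elements of a quadratic extension generated by a square root `y` have the form `α + β y`. -/
lemma exists_eq_add_mul_of_adjoin_eq_top {f : E} {y : K} (hy : y ^ 2 = algebraMap E K f)
    (htop : E⟮y⟯ = ⊤) (z : K) :
    ∃ α β : E, z = algebraMap E K α + algebraMap E K β * y := by
  have hmon : (X ^ 2 - C f : E[X]).Monic := monic_X_pow_sub_C f two_ne_zero
  have hdeg : (X ^ 2 - C f : E[X]).natDegree = 2 := natDegree_X_pow_sub_C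
  have hroot : aeval y (X ^ 2 - C f : E[X]) = 0 := by simp [hy]
  have hint : IsIntegral E y := ⟨_, hmon, hroot⟩
  have hz : z ∈ (E⟮y⟯).toSubalgebra := by rw [htop]; trivial
  rw [adjoin_simple_toSubalgebra_of_isAlgebraic hint.isAlgebraic,
    Algebra.adjoin_singleton_eq_range_aeval] at hz
  obtain ⟨p, rfl⟩ := hz
  have hlt : (p %ₘ (X ^ 2 - C f)).natDegree < 2 :=
    (natDegree_modByMonic_lt p hmon (fun h => by simp [h] at hdeg)).trans_eq hdeg
  obtain ⟨a, b, hab⟩ := exists_eq_X_add_C_of_natDegree_le_one (Nat.lt_succ_iff.mp hlt)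
  refine ⟨b, a, ?_⟩
  change aeval y p = _
  rw [← aeval_modByMonic_eq_self_of_root hroot, hab]
  simp [add_comm]

/-- In the quadratic extension of the fraction field of an integrally closed domain `R`, generated
by the square root `y` of a squarefree non-unit, the integral elements are those of `R + R y`,
provided that `2` is invertible. -/
lemma exists_eq_add_mul_of_isIntegral [IsDomain R] [IsIntegrallyClosed R] [DecompositionMonoid R]
    (h2 : IsUnit (2 : R)) {f : R} (hf : Squarefree f) (hf0 : f ≠ 0)
    (hfu : ¬ IsUnit f) {y : K} (hy : y ^ 2 = algebraMap R K f)
    (htop : IntermediateField.adjoin E {y} = ⊤) {z : K} (hz : IsIntegral R z) :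
    ∃ P Q : R, z = algebraMap R K P + algebraMap R K Q * y := by
  have hy' : y ^ 2 = algebraMap E K (algebraMap R E f) := by
    rw [hy, IsScalarTower.algebraMap_apply R E K]
  obtain ⟨α, β, rfl⟩ := exists_eq_add_mul_of_adjoin_eq_top hy' htop z
  obtain ⟨u, hu⟩ := h2
  have hcancel (r : R) (hr : algebraMap R E r = 2 * α) :
      algebraMap R E (↑u⁻¹ * r) = α := by
    have h1 : algebraMap R E (↑u⁻¹ * 2) = 1 := by rw [← hu]; simp
    rw [map_mul, map_ofNat] at h1
    rw [map_mul, hr, ← mul_assoc, h1, one_mul]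
  by_cases hβ : β = 0
  · subst hβ
    simp only [map_zero, zero_mul, add_zero] at hz ⊢
    obtain ⟨P, rfl⟩ := IsIntegrallyClosed.isIntegral_iff.mp
      ((isIntegral_algebraMap_iff (algebraMap E K).injective).mp hz)
    exact ⟨P, 0, by simp [← IsScalarTower.algebraMap_apply]⟩
  set w := algebraMap E K α + algebraMap E K β * y with hw
  set q : E[X] := X ^ 2 + C (-(2 * α)) * X + C (α ^ 2 - β ^ 2 * algebraMap R E f) with hq
  have hqm : q.Monic := by rw [hq]; monicity!
  have hqd : q.natDegree = 2 := by rw [hq]; compute_degree!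
  have hqr : aeval w q = 0 := by
    simp only [hq, hw, map_add, map_mul, map_pow, aeval_X, aeval_C, map_sub, map_neg, ← hy',
      map_ofNat]
    ring
  have hwE (e : E) : algebraMap E K e ≠ w := by
    intro he
    refine algebraMap_ne_of_sq_eq_squarefree (E := E) hf hfu hy (β⁻¹ * (e - α)) ?_
    have : algebraMap E K β ≠ 0 := by simpa using hβ
    rw [map_mul, map_sub, he, map_inv₀, hw]
    field_simp
    ring
  have hmin : minpoly E w = q := by
    have hint : IsIntegral E w := ⟨q, hqm, hqr⟩
    refine (eq_of_monic_of_dvd_of_natDegree_le (minpoly.monic hint) hqm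
      (minpoly.dvd _ _ hqr) ?_).symm
    rw [hqd]
    exact (minpoly.two_le_natDegree_iff hint).mpr fun ⟨e, he⟩ => hwE e he
  rw [minpoly.isIntegrallyClosed_eq_field_fractions' E hz] at hmin
  have hc1 := congrArg (fun p => p.coeff 1) hmin
  have hc0 := congrArg (fun p => p.coeff 0) hmin
  simp only [coeff_map, hq, coeff_add, coeff_X_pow, coeff_C_mul, coeff_X, coeff_C] at hc1 hc0
  norm_num at hc1 hc0
  obtain ⟨P, hP⟩ : ∃ P, algebraMap R E P = α :=
    ⟨_, hcancel (-(minpoly R w).coeff 1) (by rw [map_neg, hc1, neg_neg])⟩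
  set n : R := P ^ 2 - (minpoly R w).coeff 0
  have hn : β ^ 2 * algebraMap R E f = algebraMap R E n := by
    simp only [n, map_sub, map_pow, hP, hc0]; ring
  obtain ⟨m, hm⟩ := exists_algebraMap_eq_of_sq_eq (R := R) (z := β * algebraMap R E f)
    (r := n * f) (by rw [map_mul, ← hn]; ring)
  have hmn : m ^ 2 = n * f := by
    apply IsFractionRing.injective R E
    rw [map_pow, hm, map_mul, ← hn]; ring
  obtain ⟨Q, rfl⟩ : f ∣ m := hf.isRadical 2 m ⟨n, by rw [hmn, mul_comm]⟩
  have hQ : algebraMap R E Q = β := by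
    have : algebraMap R E f ≠ 0 := by simpa using hf0
    rw [map_mul, mul_comm] at hm
    exact mul_right_cancel₀ this hm
  exact ⟨P, Q, by simp [hw, ← hP, ← hQ, ← IsScalarTower.algebraMap_apply]⟩

end QuadraticExtension

section LocalRegularity

variable {k K Γ₀ : Type*} [Field k] [Field K] [Algebra k K] [LinearOrderedCommGroupWithZero Γ₀]
  {V : Valuation K Γ₀}

lemma Valuation.map_algebraMap_eq_one (hV : ∀ c : k, V (algebraMap k K c) ≤ 1) {c : k}
    (hc : c ≠ 0) : V (algebraMap k K c) = 1 := by
  refine le_antisymm (hV c) ?_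
  have h := hV c⁻¹
  rw [map_inv₀, map_inv₀] at h
  have h0 : 0 < V (algebraMap k K c) := by simpa [zero_lt_iff] using hc
  exact (inv_le_one₀ h0).mp h

lemma Valuation.map_aeval_le_one (hV : ∀ c : k, V (algebraMap k K c) ≤ 1) {u : K} (hu : V u ≤ 1)
    (G : k[X]) : V (aeval u G) ≤ 1 := by
  rw [aeval_eq_sum_range]
  refine V.map_sum_le fun i _ => ?_
  rw [Algebra.smul_def, map_mul, map_pow]
  exact mul_le_one' (hV _) (pow_le_one' hu _)

lemma Valuation.map_aeval_sub_coeff_zero_lt_one (hV : ∀ c : k, V (algebraMap k K c) ≤ 1) {u : K}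
    (hu : V u < 1) (G : k[X]) : V (aeval u G - algebraMap k K (G.coeff 0)) < 1 := by
  have : aeval u G - algebraMap k K (G.coeff 0) = aeval u G.divX * u := by
    conv_lhs => rw [← divX_mul_X_add G]
    simp
  rw [this, map_mul]
  exact mul_lt_one_of_nonneg_of_lt_one_right (Valuation.map_aeval_le_one hV hu.le _) zero_le hu

lemma Valuation.map_aeval_lt_one_iff (hV : ∀ c : k, V (algebraMap k K c) ≤ 1) {u : K}
    (hu : V u < 1) (G : k[X]) : V (aeval u G) < 1 ↔ G.coeff 0 = 0 := by
  have h := Valuation.map_aeval_sub_coeff_zero_lt_one hV hu G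
  constructor
  · intro hG
    by_contra h0
    have := (V.map_sub (aeval u G) (aeval u G - algebraMap k K (G.coeff 0))).trans_lt
      (max_lt hG h)
    rw [sub_sub_cancel, Valuation.map_algebraMap_eq_one hV h0] at this
    exact this.false
  · intro h0
    simpa [h0] using h

/-- Let `w² = R(s)`. At a place where `s` is regular and is not a multiple zero of `R`, a
derivation preserving the valuation ring takes `s` to a multiple of `w`. -/
lemma Derivation.map_div_le_one_of_sq_eq [CharZero k]
    (hV : ∀ c : k, V (algebraMap k K c) ≤ 1) (D : Derivation k K K)
    (hD : ∀ f, V f ≤ 1 → V (D f) ≤ 1) {s w : K} {R : k[X]} (hs : V s ≤ 1)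
    (hw : w ^ 2 = aeval s R) (hw0 : w ≠ 0)
    (hR : V (aeval s R) < 1 → V (aeval s (derivative R)) = 1) : V (D s / w) ≤ 1 := by
  have hw1 : V w ≤ 1 := by
    have h := Valuation.map_aeval_le_one hV hs R
    rw [← hw, map_pow] at h
    exact (pow_le_one_iff two_ne_zero).mp h
  rcases hw1.lt_or_eq with hlt | heq
  · have hd : V (aeval s (derivative R)) = 1 :=
      hR (by rw [← hw, map_pow]; exact pow_lt_one' hlt two_ne_zero)
    have hd0 : aeval s (derivative R) ≠ 0 := by
      intro h; simp [h] at hd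
    have hleib : 2 * w * D w = aeval s (derivative R) * D s := by
      have := congrArg D hw
      rw [D.leibniz_pow, D.map_aeval] at this
      simpa [mul_assoc] using this
    have : D s / w = algebraMap k K 2 * D w / aeval s (derivative R) := by
      field_simp
      rw [map_ofNat]
      linear_combination -hleib
    rw [this, map_div₀, map_mul, hd, div_one]
    exact mul_le_one' (hV 2) (hD w hw1)
  · rw [map_div₀, heq, div_one]
    exact hD s hs

lemma aeval_inv_reflect {u : K} (hu : u ≠ 0) {N : ℕ} {F : k[X]} (hF : F.natDegree ≤ N) :
    aeval u⁻¹ (reflect N F) = aeval u F / u ^ N := by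
  let := invertibleOfNonzero hu
  have := eval₂_reflect_mul_pow (algebraMap k K) u N F hF
  rw [invOf_eq_inv] at this
  rw [aeval_def, aeval_def, eq_div_iff (pow_ne_zero _ hu), this]

/-- The differentials `uⁱ du / v`, `i < g`, of the hyperelliptic curve `v² = F(u)` are regular
at each place. -/
lemma Derivation.map_pow_mul_div_le_one [CharZero k]
    (hV : ∀ c : k, V (algebraMap k K c) ≤ 1) (D : Derivation k K K)
    (hD : ∀ f, V f ≤ 1 → V (D f) ≤ 1) {u v : K} {g : ℕ} {F : k[X]} (hF : Squarefree F)
    (hdF : F.natDegree = 2 * g + 1 ∨ F.natDegree = 2 * g + 2)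
    (hv : v ^ 2 = aeval u F) (hv0 : v ≠ 0) {i : ℕ} (hi : i < g) :
    V (u ^ i * D u / v) ≤ 1 := by
  rcases le_or_gt (V u) 1 with hu | hu
  · have h : V (D u / v) ≤ 1 := by
      refine Derivation.map_div_le_one_of_sq_eq hV D hD hu hv hv0 fun hlt => ?_
      refine le_antisymm (Valuation.map_aeval_le_one hV hu _) ?_
      obtain ⟨a, b, hab⟩ := (PerfectField.separable_iff_squarefree.mpr hF)
      by_contra! hlt'
      have h1 := congrArg (fun p => V (aeval u p)) hab
      simp only [map_add, map_mul, map_one] at h1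
      have := V.map_add_lt (g := 1) (x := aeval u a * aeval u F)
        (y := aeval u b * aeval u (derivative F))
        (by rw [map_mul]; exact mul_lt_one_of_nonneg_of_lt_one_right
              (Valuation.map_aeval_le_one hV hu _) zero_le hlt)
        (by rw [map_mul]; exact mul_lt_one_of_nonneg_of_lt_one_right
              (Valuation.map_aeval_le_one hV hu _) zero_le hlt')
      exact this.ne h1
    rw [mul_div_assoc, map_mul, map_pow]
    exact mul_le_one' (pow_le_one' hu _) h
  · have hu0 : u ≠ 0 := by rintro rfl; simp at hu
    have hs : V u⁻¹ < 1 := by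
      rw [map_inv₀]; exact inv_lt_one_of_one_lt₀ hu
    have hN : F.natDegree ≤ 2 * g + 2 := by omega
    have h : V (D u⁻¹ / (v / u ^ (g + 1))) ≤ 1 := by
      refine Derivation.map_div_le_one_of_sq_eq (R := reflect (2 * g + 2) F) hV D hD hs.le ?_
        (div_ne_zero hv0 (pow_ne_zero _ hu0)) fun hlt => ?_
      · rw [aeval_inv_reflect hu0 hN, div_pow, hv, ← pow_mul]
        ring_nf
      · refine le_antisymm (Valuation.map_aeval_le_one hV hs.le _) ?_
        rw [Valuation.map_aeval_lt_one_iff hV hs, coeff_reflect, revAt_le (Nat.zero_le _)] at hlt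
        by_contra! hlt'
        rw [Valuation.map_aeval_lt_one_iff hV hs, coeff_derivative, coeff_reflect,
          revAt_le (by omega)] at hlt'
        have hlc : F.coeff F.natDegree ≠ 0 := by simpa using hF.ne_zero
        rcases hdF with h | h <;> rw [h] at hlc <;> simp_all
    have : u ^ i * D u / v = - (u⁻¹ ^ (g - 1 - i) * (D u⁻¹ / (v / u ^ (g + 1)))) := by
      obtain ⟨j, rfl⟩ : ∃ j, g = j + 1 + i := ⟨g - 1 - i, by omega⟩
      rw [D.leibniz_inv, show j + 1 + i - 1 - i = j by omega]
      simp only [smul_eq_mul, inv_pow]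
      field_simp
      ring
    rw [this, V.map_neg, map_mul, map_pow]
    exact mul_le_one' (pow_le_one' hs.le _) h

end LocalRegularity

lemma Polynomial.squarefree_reflect {k : Type*} [Field k] {F : k[X]} (hF : Squarefree F) {n : ℕ}
    (hd : F.natDegree = n ∨ F.natDegree + 1 = n) : Squarefree (reflect n F) := by
  have hF0 := hF.ne_zero
  have hn : F.natDegree ≤ n := by omega
  intro q hq
  obtain ⟨t, ht⟩ := hq
  have hR0 : q * q * t ≠ 0 := by rw [← ht]; simpa using hF0
  have hq0 : q ≠ 0 := by rintro rfl; simp at hR0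
  have ht0 : t ≠ 0 := by rintro rfl; simp at hR0
  have hle : q.natDegree + q.natDegree + t.natDegree ≤ n := by
    rw [← natDegree_mul hq0 hq0, ← natDegree_mul (mul_ne_zero hq0 hq0) ht0, ← ht]
    exact (natDegree_reflect_le).trans (max_le le_rfl hn)
  have hrefl : F = reverse q * reverse q * reflect (n - (q.natDegree + q.natDegree)) t := by
    conv_lhs => rw [← reflect_reflect (N := n) (p := F), ht,
      ← Nat.add_sub_of_le ((Nat.le_add_right _ _).trans hle)]
    rw [reflect_mul _ _ (natDegree_mul_le) (by omega), reflect_mul _ _ le_rfl le_rfl, reverse]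
  have hu : IsUnit (reverse q) := hF _ ⟨_, hrefl⟩
  by_cases hq' : q.coeff 0 = 0
  · obtain ⟨p, rfl⟩ := X_dvd_iff.mpr hq'
    have hc : (reflect n F).coeff 0 = 0 ∧ (reflect n F).coeff 1 = 0 := by
      rw [ht, show X * p * (X * p) * t = X ^ 2 * (p * p * t) by ring, coeff_X_pow_mul',
        coeff_X_pow_mul']
      simp
    have hn1 : 1 ≤ n := by
      rw [natDegree_X_mul (by rintro rfl; simp at hq0)] at hle
      omega
    rw [coeff_reflect, coeff_reflect, revAt_le (Nat.zero_le _), revAt_le hn1] at hc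
    have hlc : F.coeff F.natDegree ≠ 0 := by simpa using hF0
    rcases hd with rfl | rfl
    · exact absurd hc.1 hlc
    · exact absurd hc.2 hlc
  · have h0 : q.natDegree = 0 := by
      have h1 := natDegree_eq_reverse_natDegree_add_natTrailingDegree q
      rwa [natDegree_eq_zero_of_isUnit hu,
        natTrailingDegree_eq_zero_of_constantCoeff_ne_zero hq'] at h1
    rw [eq_C_of_natDegree_eq_zero h0]
    exact isUnit_C.mpr (isUnit_iff_ne_zero.mpr hq')

section Dedekind

variable {k K : Type*} [Field k] [Field K] [Algebra k K]

/-- A derivation of the fraction field of a Dedekind domain that preserves the domain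
preserves all its localizations. -/
lemma Derivation.valuation_le_one {A : Type*} [CommRing A] [IsDedekindDomain A] [Algebra A K]
    [IsFractionRing A K] (D : Derivation k K K)
    (hD : ∀ a : A, ∃ b : A, D (algebraMap A K a) = algebraMap A K b)
    (p : IsDedekindDomain.HeightOneSpectrum A) {f : K} (hf : p.valuation K f ≤ 1) :
    p.valuation K (D f) ≤ 1 := by
  obtain ⟨n, ⟨d, hd⟩, hnd⟩ := p.exists_primeCompl_mul_eq_of_integer f hf
  have hd1 : p.valuation K (algebraMap A K d) = 1 := p.valuation_eq_one_iff_notMem.mpr hd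
  obtain ⟨n', hn'⟩ := hD n
  obtain ⟨d', hd'⟩ := hD d
  have h : D f * algebraMap A K d = algebraMap A K n' - f * algebraMap A K d' := by
    have := congrArg D hnd
    simp only [D.leibniz, smul_eq_mul, hn', hd'] at this
    linear_combination this
  have h2 := congrArg (p.valuation K) h
  rw [map_mul, hd1, mul_one] at h2
  rw [h2]
  refine (Valuation.map_sub _ _ _).trans (max_le (p.valuation_le_one n') ?_)
  rw [map_mul]
  exact mul_le_one' hf (p.valuation_le_one d')

end Dedekind

section FunctionField

variable {k K : Type*} [Field k] [Field K] [Algebra k K]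

namespace IsHyperellipticFunctionField

variable {F : k[X]} {x y : K}

open IntermediateField in
/-- Derivations of a hyperelliptic function field are determined by their value at `x`. -/
lemma derivation_eq_zero [CharZero k] (h : IsHyperellipticFunctionField k F K x y) (hy : y ≠ 0)
    (D : Derivation k K K) (hD : D x = 0) : D = 0 := by
  have : CharZero K := charZero_of_injective_algebraMap (algebraMap k K).injective
  have hDy : D y = 0 := by
    have := congrArg D h.sq
    rw [D.leibniz_pow, D.map_aeval, hD] at this
    simpa [hy] using this
  ext z
  have hz : z ∈ IntermediateField.adjoin k ({x, y} : Set K) := by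
    rw [h.adjoin_eq_top]; trivial
  induction hz using adjoin_induction with
  | mem z hz => rcases hz with rfl | rfl <;> simp [*]
  | algebraMap c => simp
  | add a b _ _ ha hb => simp_all
  | inv a _ ha => simp_all [D.leibniz_inv]
  | mul a b _ _ ha hb => simp_all [D.leibniz]

open IntermediateField in
lemma adjoin_y_eq_top (h : IsHyperellipticFunctionField k F K x y) {E : Type*} [Field E]
    [Algebra k E] [Algebra E K] [IsScalarTower k E K] {t : E} (ht : algebraMap E K t = x) :
    IntermediateField.adjoin E ({y} : Set K) = ⊤ := by
  rw [← IntermediateField.restrictScalars_eq_top_iff (K := k), eq_top_iff, ← h.adjoin_eq_top,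
    adjoin_le_iff]
  rintro z (rfl | rfl)
  · rw [← ht]
    exact (IntermediateField.adjoin E ({y} : Set K)).algebraMap_mem t
  · exact mem_adjoin_simple_self E z

lemma not_isUnit_of_natDegree_pos (hd : 0 < F.natDegree) : ¬ IsUnit F :=
  fun hu => hd.ne' (natDegree_eq_zero_of_isUnit hu)

/-- A hyperelliptic function field is a finite extension of the rational function field `k(x)`. -/
lemma finiteDimensional [CharZero k] (h : IsHyperellipticFunctionField k F K x y)
    [Algebra k[X] K] [IsScalarTower k k[X] K] (hx : algebraMap k[X] K X = x)
    {E : Type*} [Field E] [Algebra k[X] E] [IsFractionRing k[X] E]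
    [Algebra k E] [IsScalarTower k k[X] E] [Algebra E K] [IsScalarTower k[X] E K]
    [IsScalarTower k E K] :
    FiniteDimensional E K := by
  have htop := h.adjoin_y_eq_top (E := E) (t := algebraMap k[X] E X)
    (by rw [← IsScalarTower.algebraMap_apply, hx])
  have hint : IsIntegral E y := by
    refine .of_pow two_pos ?_
    rw [h.sq, ← hx, aeval_algebraMap_apply, aeval_X_left_apply,
      IsScalarTower.algebraMap_apply k[X] E K]
    exact isIntegral_algebraMap
  have := IntermediateField.adjoin.finiteDimensional hint
  rw [htop] at this
  exact (IntermediateField.topEquiv (F := E) (E := K)).toLinearEquiv.finiteDimensional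

end IsHyperellipticFunctionField

open scoped TensorProduct in
open KaehlerDifferential in
/-- The derivation `d/dX` of `k[X]` extends to formally étale algebras. -/
lemma exists_derivation_of_formallyEtale [Algebra k[X] K] [IsScalarTower k k[X] K]
    [Algebra.FormallyEtale k[X] K] : ∃ D : Derivation k K K, D (algebraMap k[X] K X) = 1 := by
  let φ : K ⊗[k[X]] Ω[k[X]⁄k] →ₗ[K] K :=
    LinearMap.liftBaseChange K
      ((Algebra.linearMap k[X] K).comp (polynomialEquiv k).toLinearMap)
  let ψ := φ.comp (tensorKaehlerEquivOfFormallyEtale k k[X] K).symm.toLinearMap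
  refine ⟨ψ.compDer (D k K), ?_⟩
  simp [ψ, φ, tensorKaehlerEquivOfFormallyEtale_symm_D_algebraMap]


namespace IsHyperellipticFunctionField

variable {F : k[X]} {x y : K}

lemma x_ne_zero (h : IsHyperellipticFunctionField k F K x y) : x ≠ 0 := by
  rintro rfl
  exact h.transcendental_x isAlgebraic_zero

lemma y_ne_zero (h : IsHyperellipticFunctionField k F K x y) (hF : F ≠ 0) : y ≠ 0 := by
  rintro rfl
  have := h.sq
  rw [zero_pow two_ne_zero] at this
  exact hF (transcendental_iff.mp h.transcendental_x F this.symm)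

/-- If `f` is regular at all finite places of a hyperelliptic function field, then it belongs to
`k[x] + k[x] y`. It suffices to consider the places whose valuation ring is stable under
`y • D`, where `D = d/dx`. -/
lemma exists_eq_add_mul_of_forall_valuation [CharZero k]
    (h : IsHyperellipticFunctionField k F K x y) (hF : Squarefree F) (hd : 0 < F.natDegree)
    (D : Derivation k K K) (hD : D x = 1) {f : K}
    (hf : ∀ {Γ₀ : Type} [LinearOrderedCommGroupWithZero Γ₀] (V : Valuation K Γ₀),
      (∀ c : k, V (algebraMap k K c) ≤ 1) → (∀ z, V z ≤ 1 → V (y * D z) ≤ 1) → V f ≤ 1) :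
    ∃ P Q : k[X], f = aeval x P + aeval x Q * y := by
  let : Algebra k[X] K := (aeval x).toRingHom.toAlgebra
  have halg (P : k[X]) : algebraMap k[X] K P = aeval x P := rfl
  have : IsScalarTower k k[X] K := .of_algebraMap_eq fun r => (aeval_C x r).symm
  have hx : algebraMap k[X] K X = x := aeval_X x
  have : FaithfulSMul k[X] K := (faithfulSMul_iff_algebraMap_injective _ _).mpr
    (transcendental_iff_injective.mp h.transcendental_x)
  let := FractionRing.liftAlgebra k[X] K
  have := h.finiteDimensional hx (E := FractionRing k[X])
  have htop := h.adjoin_y_eq_top (E := FractionRing k[X])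
    (t := algebraMap k[X] (FractionRing k[X]) X) (by rw [← IsScalarTower.algebraMap_apply, hx])
  have : IsFractionRing (integralClosure k[X] K) K :=
    integralClosure.isFractionRing_of_finite_extension (FractionRing k[X]) K
  have hchar : CharZero (FractionRing k[X]) :=
    charZero_of_injective_algebraMap (algebraMap k (FractionRing k[X])).injective
  have h2 : IsUnit (2 : k[X]) := by
    have : IsUnit (C (2 : k)) := isUnit_C.mpr (isUnit_iff_ne_zero.mpr two_ne_zero)
    rwa [map_ofNat] at this
  have hstruct {z : K} (hz : IsIntegral k[X] z) := exists_eq_add_mul_of_isIntegral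
    (E := FractionRing k[X]) h2 hF hF.ne_zero (not_isUnit_of_natDegree_pos hd) h.sq htop hz
  have hinty : IsIntegral k[X] y := .of_pow two_pos (h.sq ▸ isIntegral_algebraMap (x := F))
  have hstable (a : integralClosure k[X] K) :
      ∃ b : integralClosure k[X] K, (y • D) (algebraMap _ K a) = algebraMap _ K b := by
    obtain ⟨P, Q, hPQ⟩ := hstruct a.2
    have hDy : y * D y = algebraMap k[X] K (C (1 / 2) * derivative F) := by
      have := congrArg D h.sq
      rw [D.leibniz_pow, D.map_aeval, hD] at this
      simp only [halg, map_mul, aeval_C, map_div₀, map_one, map_ofNat]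
      have hc : CharZero K := charZero_of_injective_algebraMap (algebraMap k K).injective
      simp at this
      linear_combination this / 2
    have : y * D (a : K) = algebraMap k[X] K (derivative P) * y +
        algebraMap k[X] K (derivative Q) * y ^ 2 +
          algebraMap k[X] K (Q * (C (1 / 2) * derivative F)) := by
      rw [map_mul, ← hDy, hPQ]
      simp only [halg, map_add, D.leibniz, D.map_aeval, hD, smul_eq_mul]
      ring
    refine ⟨⟨y * D (a : K), ?_⟩, rfl⟩
    rw [this]
    exact ((isIntegral_algebraMap.mul hinty).add (isIntegral_algebraMap.mul (hinty.pow 2))).add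
      isIntegral_algebraMap
  obtain ⟨a, rfl⟩ := IsDedekindDomain.HeightOneSpectrum.mem_integers_of_valuation_le_one
    (R := integralClosure k[X] K) K f fun p => by
      refine hf (p.valuation K) (fun c => ?_) fun z hz => ?_
      · rw [← aeval_C x c]
        exact p.valuation_le_one (K := K) (algebraMap k[X] (integralClosure k[X] K) (C c))
      · exact Derivation.valuation_le_one (y • D) hstable p hz
  exact hstruct a.2

lemma exists_derivation [CharZero k] (h : IsHyperellipticFunctionField k F K x y) :
    ∃ D : Derivation k K K, D x = 1 := by
  let : Algebra k[X] K := (aeval x).toRingHom.toAlgebra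
  have : IsScalarTower k k[X] K := .of_algebraMap_eq fun r => (aeval_C x r).symm
  have hx : algebraMap k[X] K X = x := aeval_X x
  have : FaithfulSMul k[X] K := (faithfulSMul_iff_algebraMap_injective _ _).mpr
    (transcendental_iff_injective.mp h.transcendental_x)
  let := FractionRing.liftAlgebra k[X] K
  have := h.finiteDimensional hx (E := FractionRing k[X])
  have hchar : CharZero (FractionRing k[X]) :=
    charZero_of_injective_algebraMap (algebraMap k (FractionRing k[X])).injective
  have : Algebra.FormallyEtale k[X] (FractionRing k[X]) :=
    .of_isLocalization (nonZeroDivisors k[X])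
  have : Algebra.FormallyEtale (FractionRing k[X]) K := .of_isSeparable _ _
  have : Algebra.FormallyEtale k[X] K := .comp k[X] (FractionRing k[X]) K
  simpa [hx] using exists_derivation_of_formallyEtale (k := k) (K := K)

/-- The change of coordinates `(x, y) ↦ (1 / x, y / x ^ (g + 1))`, exchanging `0` and `∞`. -/
lemma inv (h : IsHyperellipticFunctionField k F K x y) {g : ℕ} (hd : F.natDegree ≤ 2 * g + 2) :
    IsHyperellipticFunctionField k (reflect (2 * g + 2) F) K x⁻¹ (y / x ^ (g + 1)) where
  transcendental_x := fun hx => h.transcendental_x (by simpa using hx.inv)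
  sq := by
    have hx : x ≠ 0 := h.x_ne_zero
    rw [aeval_inv_reflect hx hd, div_pow, h.sq, ← pow_mul]
    ring_nf
  adjoin_eq_top := by
    have hx : x ≠ 0 := h.x_ne_zero
    set L := IntermediateField.adjoin k ({x⁻¹, y / x ^ (g + 1)} : Set K)
    have hxi : x⁻¹ ∈ L := IntermediateField.subset_adjoin _ _ (by simp)
    have hyi : y / x ^ (g + 1) ∈ L := IntermediateField.subset_adjoin _ _ (by simp)
    have hxL : x ∈ L := by simpa using inv_mem hxi
    rw [eq_top_iff, ← h.adjoin_eq_top, IntermediateField.adjoin_le_iff]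
    rintro z (rfl | rfl)
    · exact hxL
    · have := mul_mem hyi (pow_mem hxL (g + 1))
      rwa [div_mul_cancel₀ _ (pow_ne_zero _ hx)] at this

/-- `1` and `y` are linearly independent over `k[x]`. -/
lemma eq_zero_of_add_mul_eq_zero (h : IsHyperellipticFunctionField k F K x y) (hF : Squarefree F)
    (hd : 0 < F.natDegree) {P Q : k[X]} (hPQ : aeval x P + aeval x Q * y = 0) :
    P = 0 ∧ Q = 0 := by
  have hinj := transcendental_iff_injective.mp h.transcendental_x
  have h1 : P ^ 2 = Q ^ 2 * F := by
    apply hinj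
    rw [map_pow, map_mul, map_pow, ← h.sq]
    linear_combination (aeval x P - aeval x Q * y) * hPQ
  have hQ : Q = 0 := by
    by_contra hQ
    obtain ⟨S, rfl⟩ : Q ∣ P := (IsIntegrallyClosed.pow_dvd_pow_iff two_ne_zero).mp ⟨F, h1⟩
    have h2 : S ^ 2 = F := mul_left_cancel₀ (pow_ne_zero 2 hQ) (by rw [← h1, mul_pow])
    have hS := hF S ⟨1, by rw [← h2]; ring⟩
    exact not_isUnit_of_natDegree_pos hd (h2 ▸ hS.pow 2)
  subst hQ
  refine ⟨?_, rfl⟩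
  simpa using h1


lemma natDegree_reflect_pos {g : ℕ} (hF : Squarefree F) :
    0 < (reflect (2 * g + 2) F).natDegree := by
  by_contra! h0
  have h1 := eq_C_of_natDegree_le_zero h0
  have h2 : F = C ((reflect (2 * g + 2) F).coeff 0) * X ^ (2 * g + 2) := by
    rw [← reflect_C, ← h1, reflect_reflect]
  refine not_isUnit_X (hF X ?_)
  rw [h2]
  exact Dvd.intro_left _ (by ring : C _ * X ^ (2 * g) * (X * X) = _)

/-- The holomorphic differentials `uⁱ du / v`, `i < g`, are of the form `P(x) dx / y` with
`deg P < g`. -/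
lemma exists_eq_aeval_of_regular [CharZero k] (h : IsHyperellipticFunctionField k F K x y)
    (hF : Squarefree F) {g : ℕ} (hdF : F.natDegree = 2 * g + 1 ∨ F.natDegree = 2 * g + 2)
    (D : Derivation k K K) (hD : D x = 1) {F' : k[X]} (hF' : Squarefree F')
    (hdF' : F'.natDegree = 2 * g + 1 ∨ F'.natDegree = 2 * g + 2) {u v : K}
    (hv : v ^ 2 = aeval u F') (hv0 : v ≠ 0) {i : ℕ} (hi : i < g) :
    ∃ P : k[X], P.natDegree < g ∧ y * (u ^ i * D u / v) = aeval x P := by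
  have hx : x ≠ 0 := h.x_ne_zero
  have hd : F.natDegree ≤ 2 * g + 2 := by omega
  have hdpos : 0 < F.natDegree := by omega
  obtain ⟨P, Q, hPQ⟩ := h.exists_eq_add_mul_of_forall_valuation hF hdpos D hD
    (f := u ^ i * (y • D) u / v) fun V hV hstab =>
      Derivation.map_pow_mul_div_le_one hV (y • D) hstab hF' hdF' hv hv0 hi
  have hD' : (-x ^ 2 • D) x⁻¹ = 1 := by
    simp [D.leibniz_inv, hD, hx]
  obtain ⟨P₂, Q₂, hPQ₂⟩ := (h.inv hd).exists_eq_add_mul_of_forall_valuation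
    (squarefree_reflect hF (by omega)) (natDegree_reflect_pos hF) (-x ^ 2 • D) hD'
    (f := u ^ i * ((y / x ^ (g + 1)) • (-x ^ 2 • D)) u / v) fun V hV hstab =>
      Derivation.map_pow_mul_div_le_one hV ((y / x ^ (g + 1)) • (-x ^ 2 • D)) hstab
        hF' hdF' hv hv0 hi
  set N := max P₂.natDegree Q₂.natDegree
  have hP₂ : (reflect N P₂).natDegree ≤ N :=
    natDegree_reflect_le.trans (max_le le_rfl (le_max_left _ _))
  have hQ₂ : (reflect N Q₂).natDegree ≤ N :=
    natDegree_reflect_le.trans (max_le le_rfl (le_max_right _ _))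
  have hP₃ := aeval_inv_reflect hx hP₂
  have hQ₃ := aeval_inv_reflect hx hQ₂
  rw [reflect_reflect] at hP₃ hQ₃
  simp only [Derivation.smul_apply, smul_eq_mul] at hPQ hPQ₂
  have hrel : aeval x (X ^ (N + 2) * P + X ^ (g + 1) * reflect N P₂) +
      aeval x (X ^ (N + 2) * Q + reflect N Q₂) * y = 0 := by
    have h1 : u ^ i * (y / x ^ (g + 1) * (-x ^ 2 * D u)) / v =
        -x ^ 2 / x ^ (g + 1) * (u ^ i * (y * D u) / v) := by ring
    rw [h1, hPQ, hP₃, hQ₃] at hPQ₂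
    field_simp at hPQ₂
    simp only [map_add, map_mul, map_pow, aeval_X]
    linear_combination -hPQ₂
  obtain ⟨hPr, hQr⟩ := h.eq_zero_of_add_mul_eq_zero hF hdpos hrel
  have hQ0 : Q = 0 := by
    by_contra hQ0
    have h1 := congrArg natDegree (eq_neg_of_add_eq_zero_left hQr)
    rw [natDegree_neg, natDegree_X_pow_mul _ hQ0] at h1
    omega
  refine ⟨P, ?_, ?_⟩
  · by_cases hP0 : P = 0
    · rw [hP0, natDegree_zero]; omega
    have h1 := congrArg natDegree (eq_neg_of_add_eq_zero_left hPr)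
    rw [natDegree_neg, natDegree_X_pow_mul _ hP0] at h1
    have h2 := natDegree_mul_le (p := (X : k[X]) ^ (g + 1)) (q := reflect N P₂)
    rw [natDegree_X_pow] at h2
    omega
  · rw [hQ0, map_zero, zero_mul, add_zero] at hPQ
    rw [← hPQ]
    ring

lemma map {K' : Type*} [Field K'] [Algebra k K'] (h : IsHyperellipticFunctionField k F K x y)
    (σ : K ≃ₐ[k] K') : IsHyperellipticFunctionField k F K' (σ x) (σ y) where
  transcendental_x := fun hx => h.transcendental_x
    ((isAlgebraic_algHom_iff σ.toAlgHom σ.injective).mp hx)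
  sq := by
    rw [← map_pow, h.sq]
    exact (aeval_algHom_apply σ x F).symm
  adjoin_eq_top := by
    have := congrArg (IntermediateField.map (σ : K →ₐ[k] K')) h.adjoin_eq_top
    rw [IntermediateField.adjoin_map, Set.image_pair, ← AlgHom.fieldRange_eq_map,
      AlgHom.fieldRange_eq_top.mpr σ.surjective] at this
    exact this

/-- A fraction of polynomials can be put in lowest terms. -/
lemma exists_isCoprime_mul_eq_mul (P : k[X]) {R : k[X]} (hR : R ≠ 0) :
    ∃ p q : k[X], q ≠ 0 ∧ IsCoprime p q ∧ P * q = R * p := by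
  classical
  obtain ⟨p, q, hp, hq, hpq⟩ := extract_gcd P R
  refine ⟨p, q, right_ne_zero_of_mul (hq ▸ hR), (gcd_isUnit_iff _ _).mp hpq, ?_⟩
  conv_lhs => rw [hp]
  conv_rhs => rw [hq]
  ring

lemma exists_eq_pow_mul_of_isCoprime {p q P R : k[X]} {n : ℕ} (hpq : IsCoprime p q)
    (h : p ^ n * P = q ^ n * R) (hq : q ≠ 0) : ∃ S, P = q ^ n * S ∧ R = p ^ n * S := by
  obtain ⟨S, rfl⟩ := hpq.symm.pow.dvd_of_dvd_mul_left ⟨R, h⟩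
  exact ⟨S, rfl, mul_left_cancel₀ (pow_ne_zero n hq) (by rw [← h]; ring)⟩

/-- Two presentations of a hyperelliptic function field of genus `g ≥ 2` are related by a
fractional linear transformation. -/
lemma exists_fractional_linear [CharZero k] (h : IsHyperellipticFunctionField k F K x y)
    (hF : Squarefree F) {g : ℕ} (hg : 2 ≤ g)
    (hdF : F.natDegree = 2 * g + 1 ∨ F.natDegree = 2 * g + 2) {F' : k[X]} (hF' : Squarefree F')
    (hdF' : F'.natDegree = 2 * g + 1 ∨ F'.natDegree = 2 * g + 2) {u v : K}
    (h' : IsHyperellipticFunctionField k F' K u v) :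
    ∃ a b c d e : k, a * d - b * c ≠ 0 ∧ e ≠ 0 ∧
      u = (algebraMap k K a * x + algebraMap k K b) / (algebraMap k K c * x + algebraMap k K d) ∧
      v = algebraMap k K e * y / (algebraMap k K c * x + algebraMap k K d) ^ (g + 1) := by
  have hinj : Function.Injective (aeval x : k[X] →ₐ[k] K) :=
    transcendental_iff_injective.mp h.transcendental_x
  have hinj0 {P : k[X]} (hP : P ≠ 0) : aeval x P ≠ 0 := by
    rwa [Ne, map_eq_zero_iff _ hinj]
  have hy0 : y ≠ 0 := h.y_ne_zero hF.ne_zero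
  have hv0 : v ≠ 0 := h'.y_ne_zero hF'.ne_zero
  obtain ⟨D, hD⟩ := h.exists_derivation
  have hDu : D u ≠ 0 := by
    intro h0
    rw [h'.derivation_eq_zero hv0 D h0] at hD
    simp at hD
  have hreg {i : ℕ} (hi : i < g) :=
    h.exists_eq_aeval_of_regular hF hdF D hD hF' hdF' h'.sq hv0 hi
  obtain ⟨P₀, -, hP₀⟩ := hreg (i := 0) (by omega)
  obtain ⟨P₁, -, hP₁⟩ := hreg (i := 1) (by omega)
  obtain ⟨n, rfl⟩ : ∃ n, g = n + 1 := ⟨g - 1, by omega⟩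
  obtain ⟨Pₙ, hPₙd, hPₙ⟩ := hreg (i := n) (by omega)
  obtain ⟨P₀', hP₀d, hP₀'⟩ := hreg (i := 0) (by omega)
  obtain rfl : P₀' = P₀ := hinj (hP₀'.symm.trans hP₀)
  rw [pow_zero, one_mul] at hP₀
  rw [pow_one] at hP₁
  have hP₀0 : P₀' ≠ 0 := by
    rintro rfl
    rw [map_zero] at hP₀
    exact mul_ne_zero hy0 (div_ne_zero hDu hv0) hP₀
  have hPₙ0 : Pₙ ≠ 0 := by
    rintro rfl
    rw [map_zero] at hPₙ
    exact mul_ne_zero hy0 (div_ne_zero (mul_ne_zero (pow_ne_zero n h'.x_ne_zero) hDu) hv0) hPₙ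
  obtain ⟨p, q, hq0, hpq, hpq'⟩ := exists_isCoprime_mul_eq_mul P₁ hP₀0
  have huq : u * aeval x q = aeval x p := by
    have h1 := congrArg (aeval x) hpq'
    rw [map_mul, map_mul, ← hP₀, ← hP₁] at h1
    field_simp at h1
    linear_combination h1
  obtain ⟨S, rfl, rfl⟩ := exists_eq_pow_mul_of_isCoprime (n := n) (P := P₀') (R := Pₙ) hpq (by
    apply hinj
    rw [map_mul, map_mul, map_pow, map_pow, ← huq, ← hP₀, ← hPₙ]
    ring) hq0
  have hS0 : S ≠ 0 := right_ne_zero_of_mul hP₀0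
  have hp0 : p ^ n ≠ 0 := left_ne_zero_of_mul hPₙ0
  rw [natDegree_mul (pow_ne_zero n hq0) hS0, natDegree_pow] at hP₀d
  rw [natDegree_mul hp0 hS0, natDegree_pow] at hPₙd
  have hp1 : p.natDegree ≤ 1 := by
    by_contra! hlt
    have := Nat.mul_le_mul_left n hlt
    omega
  have hq1 : q.natDegree ≤ 1 := by
    by_contra! hlt
    have := Nat.mul_le_mul_left n hlt
    omega
  have hqx : aeval x q ≠ 0 := hinj0 hq0
  have hSdeg (h1 : p.natDegree ≠ 0 ∨ q.natDegree ≠ 0) : S.natDegree = 0 := by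
    rcases h1 with h1 | h1
    · rw [show p.natDegree = 1 by omega] at hPₙd
      omega
    · rw [show q.natDegree = 1 by omega] at hP₀d
      omega
  obtain ⟨a, b, rfl⟩ := exists_eq_X_add_C_of_natDegree_le_one hp1
  obtain ⟨c, d, rfl⟩ := exists_eq_X_add_C_of_natDegree_le_one hq1
  simp only [map_mul, map_add, aeval_C, aeval_X, map_pow] at huq hqx hP₀
  have hdet : D u * (algebraMap k K c * x + algebraMap k K d) ^ 2 =
      algebraMap k K (a * d - b * c) := by
    have h1 := congrArg D huq
    simp only [D.leibniz, map_add, hD, D.map_algebraMap, smul_eq_mul] at h1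
    simp only [map_sub, map_mul]
    linear_combination (algebraMap k K c * x + algebraMap k K d) * h1 - algebraMap k K c * huq
  have hdet0 : a * d - b * c ≠ 0 := by
    intro h0
    rw [h0, map_zero] at hdet
    exact mul_ne_zero hDu (pow_ne_zero 2 hqx) hdet
  obtain ⟨s, rfl⟩ : ∃ s, S = C s := by
    refine ⟨_, eq_C_of_natDegree_eq_zero (hSdeg ?_)⟩
    by_contra! h0
    have ha : a = 0 := by simpa [coeff_C] using coeff_eq_zero_of_natDegree_lt (h0.1.trans_lt one_pos)
    have hc : c = 0 := by simpa [coeff_C] using coeff_eq_zero_of_natDegree_lt (h0.2.trans_lt one_pos)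
    simp [ha, hc] at hdet0
  have hs : s ≠ 0 := by simpa using hS0
  refine ⟨a, b, c, d, (a * d - b * c) / s, hdet0, div_ne_zero hdet0 hs, eq_div_of_mul_eq hqx huq,
    ?_⟩
  have hs' : algebraMap k K s ≠ 0 := by simpa using hs
  rw [map_div₀, ← hdet]
  rw [aeval_C] at hP₀
  field_simp at hP₀ ⊢
  linear_combination -(algebraMap k K c * x + algebraMap k K d) ^ 2 * hP₀

end IsHyperellipticFunctionField

end FunctionField


/-- Every `k`-algebra isomorphism between hyperelliptic function fields of the same
genus `g ≥ 2` (over a field `k` of characteristic zero) is represented by some pair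
`(M, e) ∈ GL₂(k) × kˣ`. -/
theorem stmt_3 {k : Type*} [Field k] [CharZero k] (g : ℕ) (hg : 2 ≤ g)
    (F F' : k[X]) (hF : Squarefree F)
    (hdF : F.natDegree = 2 * g + 1 ∨ F.natDegree = 2 * g + 2)
    (hF' : Squarefree F')
    (hdF' : F'.natDegree = 2 * g + 1 ∨ F'.natDegree = 2 * g + 2)
    {K K' : Type*} [Field K] [Algebra k K] [Field K'] [Algebra k K']
    (x y : K) (x' y' : K')
    (hK : IsHyperellipticFunctionField k F K x y)
    (hK' : IsHyperellipticFunctionField k F' K' x' y')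
    (σ : K' ≃ₐ[k] K) :
    ∃ (M : GL (Fin 2) k) (e : kˣ), Represents g x y x' y' σ M e := by
  obtain ⟨a, b, c, d, e, hdet, he, hu, hv⟩ :=
    hK.exists_fractional_linear hF hg hdF hF' hdF' (hK'.map σ)
  refine ⟨Matrix.GeneralLinearGroup.mkOfDetNeZero !![a, b; c, d]
    (by simpa [Matrix.det_fin_two] using hdet), Units.mk0 e he, ?_, ?_⟩
  · simpa [Matrix.GeneralLinearGroup.mkOfDetNeZero] using hu
  · simpa [Matrix.GeneralLinearGroup.mkOfDetNeZero] using hv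
end
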